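/- Let g ∈ F((x^{-1})) satisfy P*(x)·g(x^d) = g(x) with deg P* ≤ d-1, d ≥ 2, and suppose g has infinite continued fraction expansion. Then g is badly approximable (all partial quotients have uniformly bounded degree) if and only if every partial quotient a_n(x), n ≥ 1, of the continued fraction of g is linear (has degree exactly 1). -/

import Mathlib

open Polynomial
open scoped Classical

noncomputable section

variable {F : Type*} [Field F]

/-- The element `x = T⁻¹` of `F((T))`. -/
def xx : LaurentSeries F := ((PowerSeries.X : PowerSeries F) : LaurentSeries F)⁻¹

/-- Evaluation of a polynomial in the variable `x` inside `F((x⁻¹))`. -/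
def pev (p : Polynomial F) : LaurentSeries F := Polynomial.aeval (xx : LaurentSeries F) p

/-- Degree valuation `‖f‖` on `F((x⁻¹))`, with `‖0‖ = ⊥`. -/
def degB (f : LaurentSeries F) : WithBot ℤ := if f = 0 then ⊥ else (-(f.order) : ℤ)

/-- Substitution `x ↦ x^d` (equivalently `T ↦ T^d`) on Laurent series. -/
def lsubst (d : ℕ) (f : LaurentSeries F) : LaurentSeries F :=
  if h : 0 < d then
    HahnSeries.embDomain
      (OrderEmbedding.ofStrictMono (fun n : ℤ => (d : ℤ) * n)
        (fun _ _ hab => mul_lt_mul_of_pos_left hab (by exact_mod_cast h))) f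
  else 0

/-- The polynomial part of a Laurent series in `x⁻¹`. -/
def polyPart (f : LaurentSeries F) : LaurentSeries F :=
  ∑ i ∈ Finset.Icc f.order 0, HahnSeries.single i (f.coeff i)

/-- The complete quotients (tails) of the continued fraction algorithm for `f`. -/
def cfTail (f : LaurentSeries F) : ℕ → LaurentSeries F
  | 0 => f
  | n + 1 => (cfTail f n - polyPart (cfTail f n))⁻¹

/-- The `n`-th partial quotient `a_n(x)` of the continued fraction of `f`. -/
def cfA (f : LaurentSeries F) (n : ℕ) : LaurentSeries F := polyPart (cfTail f n)

open HahnSeries in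
theorem xx_pow (n : ℕ) : (xx : LaurentSeries F) ^ n = single (-(n : ℤ)) 1 := by
  rw [xx, ofPowerSeries_X, inv_single, single_pow]
  simp

theorem pev_monomial (n : ℕ) (a : F) :
    pev (monomial n a) = HahnSeries.single (-(n : ℤ)) a := by
  rw [pev, aeval_monomial, xx_pow, HahnSeries.algebraMap_apply', PowerSeries.algebraMap_apply,
    Algebra.algebraMap_self_apply, HahnSeries.ofPowerSeries_C, HahnSeries.C_apply,
    HahnSeries.single_mul_single, zero_add, mul_one]

theorem pev_eq_sum (p : F[X]) :
    pev p = ∑ i ∈ Finset.range (p.natDegree + 1), HahnSeries.single (-(i : ℤ)) (p.coeff i) := by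
  conv_lhs => rw [p.as_sum_range]
  rw [pev, map_sum]
  exact Finset.sum_congr rfl fun i _ => pev_monomial i _

theorem pev_sub (p q : F[X]) : pev (p - q) = pev p - pev q := map_sub _ p q

theorem pev_mul (p q : F[X]) : pev (p * q) = pev p * pev q := map_mul _ p q

theorem le_orderTop_iff_le_order {f : LaurentSeries F} (hf : f ≠ 0) {k : ℤ} :
    (k : WithTop ℤ) ≤ f.orderTop ↔ k ≤ f.order := by
  rw [← HahnSeries.order_eq_orderTop_of_ne_zero hf, WithTop.coe_le_coe]

theorem le_orderTop_sub {f g : LaurentSeries F} {k : WithTop ℤ} (hf : k ≤ f.orderTop)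
    (hg : k ≤ g.orderTop) : k ≤ (f - g).orderTop :=
  (le_min hf hg).trans HahnSeries.min_orderTop_le_orderTop_sub

theorem le_orderTop_mul {f g : LaurentSeries F} {a b : ℤ} (hf : (a : WithTop ℤ) ≤ f.orderTop)
    (hg : (b : WithTop ℤ) ≤ g.orderTop) : ((a + b : ℤ) : WithTop ℤ) ≤ (f * g).orderTop := by
  rw [HahnSeries.orderTop_mul, WithTop.coe_add]
  exact add_le_add hf hg

theorem order_inv {f : LaurentSeries F} (hf : f ≠ 0) : f⁻¹.order = -f.order := by
  have h := HahnSeries.order_mul hf (inv_ne_zero hf)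
  rw [mul_inv_cancel₀ hf, HahnSeries.order_one] at h
  omega

theorem neg_natDegree_le_orderTop_pev (p : F[X]) :
    ((-(p.natDegree : ℤ) : ℤ) : WithTop ℤ) ≤ (pev p).orderTop := by
  rw [HahnSeries.le_orderTop_iff_forall]
  intro j hj
  rw [WithTop.coe_lt_coe] at hj
  rw [pev_eq_sum, HahnSeries.coeff_sum]
  refine Finset.sum_eq_zero fun i hi => HahnSeries.coeff_single_of_ne ?_
  rw [Finset.mem_range] at hi
  omega

theorem order_pev_nonpos (p : F[X]) : (pev p).order ≤ 0 := by
  by_contra! h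
  have h0 : pev p ≠ 0 := by
    rintro h0
    simp [h0] at h
  refine (HahnSeries.coeff_order_eq_zero.not.mpr h0) ?_
  generalize (pev p).order = k at h
  rw [pev_eq_sum, HahnSeries.coeff_sum]
  refine Finset.sum_eq_zero fun i hi => HahnSeries.coeff_single_of_ne ?_
  omega

theorem exists_pev_eq_polyPart (f : LaurentSeries F) : ∃ p : F[X], pev p = polyPart f := by
  refine ⟨∑ i ∈ Finset.Icc f.order 0, monomial (-i).toNat (f.coeff i), ?_⟩
  rw [pev, map_sum, polyPart]
  refine Finset.sum_congr rfl fun i hi => ?_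
  rw [Finset.mem_Icc] at hi
  refine (pev_monomial _ _).trans ?_
  rw [show -((-i).toNat : ℤ) = i by omega]

theorem coeff_polyPart_of_nonpos (f : LaurentSeries F) {j : ℤ} (hj : j ≤ 0) :
    (polyPart f).coeff j = f.coeff j := by
  rw [polyPart, HahnSeries.coeff_sum]
  by_cases h : f.order ≤ j
  · rw [Finset.sum_eq_single_of_mem j (Finset.mem_Icc.mpr ⟨h, hj⟩)
      fun i _ hi => HahnSeries.coeff_single_of_ne hi.symm, HahnSeries.coeff_single_same]
  · rw [HahnSeries.coeff_eq_zero_of_lt_order (not_le.mp h)]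
    refine Finset.sum_eq_zero fun i hi => HahnSeries.coeff_single_of_ne ?_
    rw [Finset.mem_Icc] at hi
    omega

theorem one_le_order_sub_polyPart {f : LaurentSeries F} (hf : f ≠ polyPart f) :
    1 ≤ (f - polyPart f).order := by
  rw [HahnSeries.le_order_iff_forall (sub_ne_zero.mpr hf)]
  intro j hj
  rw [HahnSeries.coeff_sub, coeff_polyPart_of_nonpos f (by omega), sub_self]

theorem degB_polyPart {f : LaurentSeries F} (hf : f ≠ 0) (h : f.order ≤ 0) :
    degB (polyPart f) = ((-f.order : ℤ) : WithBot ℤ) := by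
  have hc : (polyPart f).coeff f.order ≠ 0 := by
    rw [coeff_polyPart_of_nonpos f h]
    exact HahnSeries.coeff_order_eq_zero.not.mpr hf
  have h0 := HahnSeries.ne_zero_of_coeff_ne_zero hc
  have horder : (polyPart f).order = f.order := by
    refine le_antisymm (HahnSeries.order_le_of_coeff_ne_zero hc) ?_
    rw [HahnSeries.le_order_iff_forall h0]
    intro j hj
    rw [coeff_polyPart_of_nonpos f (by omega), HahnSeries.coeff_eq_zero_of_lt_order hj]
  rw [degB, if_neg h0, horder]

theorem cfTail_succ_eq_cfTail_inv (f : LaurentSeries F) (n : ℕ) :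
    cfTail f (n + 1) = cfTail (f - polyPart f)⁻¹ n := by
  induction n with
  | zero => rfl
  | succ n ih => rw [cfTail, ih, cfTail]

theorem cfTail_succ_ne_zero {f : LaurentSeries F} {n : ℕ} (h : cfTail f n ≠ polyPart (cfTail f n)) :
    cfTail f (n + 1) ≠ 0 := by
  rw [cfTail]
  exact inv_ne_zero (sub_ne_zero.mpr h)

theorem order_cfTail_succ_le {f : LaurentSeries F} {n : ℕ}
    (h : cfTail f n ≠ polyPart (cfTail f n)) : (cfTail f (n + 1)).order ≤ -1 := by
  rw [cfTail, order_inv (sub_ne_zero.mpr h)]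
  have := one_le_order_sub_polyPart h
  omega

theorem degB_cfA_succ {f : LaurentSeries F} {n : ℕ} (h : cfTail f n ≠ polyPart (cfTail f n)) :
    degB (cfA f (n + 1)) = ((-(cfTail f (n + 1)).order : ℤ) : WithBot ℤ) := by
  have := order_cfTail_succ_le h
  exact degB_polyPart (cfTail_succ_ne_zero h) (by omega)

/-- Some fraction `p / q` satisfies `‖q f - p‖ ≤ -‖q‖ - e`. -/
def HasApprox (f : LaurentSeries F) (e : ℤ) : Prop :=
  ∃ p q : F[X], pev q ≠ 0 ∧
    ((e - (pev q).order : ℤ) : WithTop ℤ) ≤ (pev q * f - pev p).orderTop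

theorem hasApprox_of_cfTail (n : ℕ) (f : LaurentSeries F)
    (hf : ∀ n, cfTail f n ≠ polyPart (cfTail f n)) :
    HasApprox f (-(cfTail f (n + 1)).order) := by
  induction n generalizing f with
  | zero =>
    obtain ⟨a, ha⟩ := exists_pev_eq_polyPart f
    have h0 : f - polyPart f ≠ 0 := sub_ne_zero.mpr (hf 0)
    have h1 : pev (1 : F[X]) = 1 := map_one _
    refine ⟨a, 1, by simp [h1], ?_⟩
    rw [cfTail, cfTail, order_inv h0, h1, ha, one_mul, HahnSeries.order_one,
      le_orderTop_iff_le_order h0]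
    omega
  | succ n ih =>
    obtain ⟨a, ha⟩ := exists_pev_eq_polyPart f
    have h0 : f - polyPart f ≠ 0 := sub_ne_zero.mpr (hf 0)
    have hpos := one_le_order_sub_polyPart (hf 0)
    have htail := order_cfTail_succ_le (hf (n + 1))
    obtain ⟨p, q, hq, hpq⟩ := ih (f - polyPart f)⁻¹ fun n => by
      rw [← cfTail_succ_eq_cfTail_inv]
      exact hf (n + 1)
    rw [← cfTail_succ_eq_cfTail_inv] at hpq
    rw [show cfTail f 0 = f from rfl] at hpos
    set e := -(cfTail f (n + 1 + 1)).order with he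
    set h := f - polyPart f with hh
    have hqo := order_pev_nonpos q
    have hqh : pev q * h⁻¹ ≠ 0 := mul_ne_zero hq (inv_ne_zero h0)
    have hqho : (pev q * h⁻¹).order = (pev q).order - h.order := by
      rw [HahnSeries.order_mul hq (inv_ne_zero h0), order_inv h0, sub_eq_add_neg]
    have hlt : (pev q * h⁻¹).orderTop < (pev q * h⁻¹ - pev p).orderTop := by
      refine lt_of_lt_of_le ?_ hpq
      rw [← HahnSeries.order_eq_orderTop_of_ne_zero hqh, WithTop.coe_lt_coe]
      omega
    have hptop : (pev p).orderTop = (pev q * h⁻¹).orderTop := by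
      rw [← HahnSeries.orderTop_sub hlt, sub_sub_cancel]
    have hp : pev p ≠ 0 := by
      rw [← HahnSeries.orderTop_ne_top, hptop, HahnSeries.orderTop_ne_top]
      exact hqh
    have hpo : (pev p).order = (pev q).order - h.order := by
      rw [← HahnSeries.order_eq_orderTop_of_ne_zero hp,
        ← HahnSeries.order_eq_orderTop_of_ne_zero hqh, WithTop.coe_eq_coe] at hptop
      rw [hptop, hqho]
    refine ⟨q + p * a, p, hp, ?_⟩
    have hkey : pev p * f - pev (q + p * a) = -((pev q * h⁻¹ - pev p) * h) := by
      rw [show pev (q + p * a) = pev q + pev p * pev a by simp [pev], ha, sub_mul,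
        inv_mul_cancel_right₀ h0, hh]
      ring
    rw [hkey, HahnSeries.orderTop_neg]
    have := le_orderTop_mul hpq ((le_orderTop_iff_le_order h0).mpr le_rfl)
    rwa [show e - (pev p).order = e - (pev q).order + h.order by omega]

theorem exists_le_neg_order_cfTail {e : ℤ} (he : 1 ≤ e) (m : ℕ) (f : LaurentSeries F)
    (hf : ∀ n, cfTail f n ≠ polyPart (cfTail f n)) (p q : F[X]) (hq : pev q ≠ 0)
    (hm : -(pev q).order < m)
    (hpq : ((e - (pev q).order : ℤ) : WithTop ℤ) ≤ (pev q * f - pev p).orderTop) :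
    ∃ n, e ≤ -(cfTail f (n + 1)).order := by
  induction m generalizing f p q with
  | zero =>
    have := order_pev_nonpos q
    omega
  | succ m ih =>
    obtain ⟨a, ha⟩ := exists_pev_eq_polyPart f
    have h0 : f - polyPart f ≠ 0 := sub_ne_zero.mpr (hf 0)
    have hpos := one_le_order_sub_polyPart (hf 0)
    rw [show cfTail f 0 = f from rfl] at hpos
    have htail : (cfTail f 1).order = -(f - polyPart f).order := order_inv h0
    have hshift := cfTail_succ_eq_cfTail_inv f
    set h := f - polyPart f with hh
    have hqo := order_pev_nonpos q
    have hqho := HahnSeries.order_mul hq h0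
    have hqh := mul_ne_zero hq h0
    set r := pev q * f - pev p with hr
    have hp' : pev (p - q * a) = pev q * h - r := by
      rw [pev_sub, pev_mul, ha, hh, hr]
      ring
    by_cases hp0 : pev (p - q * a) = 0
    · refine ⟨0, ?_⟩
      rw [hp0, eq_comm, sub_eq_zero] at hp'
      rw [← hp', le_orderTop_iff_le_order hqh] at hpq
      rw [zero_add, htail]
      omega
    · have hp'o := order_pev_nonpos (p - q * a)
      have hle : (pev q).order + h.order ≤ (pev (p - q * a)).order := by
        by_contra! hlt
        have : (((pev (p - q * a)).order + 1 : ℤ) : WithTop ℤ) ≤ (pev (p - q * a)).orderTop := by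
          conv_rhs => rw [hp']
          refine le_orderTop_sub ((le_orderTop_iff_le_order hqh).mpr (by omega)) (le_trans ?_ hpq)
          rw [WithTop.coe_le_coe]
          omega
        rw [le_orderTop_iff_le_order hp0] at this
        omega
      have hkey : pev (p - q * a) * h⁻¹ - pev q = -(r * h⁻¹) := by
        rw [hp', sub_mul, mul_inv_cancel_right₀ h0]
        ring
      obtain ⟨n, hn⟩ := ih h⁻¹ (fun n => by rw [← hshift]; exact hf (n + 1)) q (p - q * a) hp0
        (by omega) (by
          rw [hkey, HahnSeries.orderTop_neg]
          refine le_trans ?_ (le_orderTop_mul hpq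
            ((le_orderTop_iff_le_order (inv_ne_zero h0)).mpr le_rfl))
          rw [order_inv h0, WithTop.coe_le_coe]
          omega)
      exact ⟨n + 1, by rwa [hshift]⟩

theorem HasApprox.exists_le_neg_order_cfTail {f : LaurentSeries F} {e : ℤ} (h : HasApprox f e)
    (he : 1 ≤ e) (hf : ∀ n, cfTail f n ≠ polyPart (cfTail f n)) :
    ∃ n, e ≤ -(cfTail f (n + 1)).order := by
  obtain ⟨p, q, hq, hpq⟩ := h
  exact _root_.exists_le_neg_order_cfTail he ((-(pev q).order).toNat + 1) f hf p q hq (by omega) hpq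

theorem HasApprox.mono {f : LaurentSeries F} {e e' : ℤ} (h : HasApprox f e) (he : e' ≤ e) :
    HasApprox f e' := by
  obtain ⟨p, q, hq, hpq⟩ := h
  exact ⟨p, q, hq, le_trans (WithTop.coe_le_coe.mpr (by omega)) hpq⟩

section lsubst

variable {d : ℕ}

theorem lsubst_single (hd : 0 < d) (i : ℤ) (a : F) :
    lsubst d (HahnSeries.single i a) = HahnSeries.single (d * i) a := by
  rw [lsubst, dif_pos hd, HahnSeries.embDomain_single]
  rfl

theorem lsubst_add (hd : 0 < d) (f g : LaurentSeries F) :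
    lsubst d (f + g) = lsubst d f + lsubst d g := by
  simp only [lsubst, dif_pos hd, HahnSeries.embDomain_add]

theorem lsubst_sub (hd : 0 < d) (f g : LaurentSeries F) :
    lsubst d (f - g) = lsubst d f - lsubst d g := by
  rw [eq_sub_iff_add_eq, ← lsubst_add hd, sub_add_cancel]

theorem lsubst_mul (hd : 0 < d) (f g : LaurentSeries F) :
    lsubst d (f * g) = lsubst d f * lsubst d g := by
  simp only [lsubst, dif_pos hd]
  exact HahnSeries.embDomain_mul _ (fun x y => mul_add (d : ℤ) x y) f g

theorem lsubst_pev (hd : 0 < d) (p : F[X]) : lsubst d (pev p) = pev (expand F d p) := by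
  induction p using Polynomial.induction_on' with
  | add p q hp hq =>
    rw [show pev (p + q) = pev p + pev q from map_add _ p q, lsubst_add hd, hp, hq, map_add]
    exact (map_add _ _ _).symm
  | monomial n a =>
    rw [pev_monomial, lsubst_single hd, expand_monomial, pev_monomial]
    congr 2
    push_cast
    ring

theorem lsubst_ne_zero (hd : 0 < d) {f : LaurentSeries F} (hf : f ≠ 0) : lsubst d f ≠ 0 := by
  rw [lsubst, dif_pos hd]
  exact fun h => hf (HahnSeries.embDomain_injective (h.trans HahnSeries.embDomain_zero.symm))

theorem order_lsubst (hd : 0 < d) {f : LaurentSeries F} (hf : f ≠ 0) :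
    (lsubst d f).order = d * f.order := by
  rw [← WithTop.coe_eq_coe, HahnSeries.order_eq_orderTop_of_ne_zero (lsubst_ne_zero hd hf), lsubst,
    dif_pos hd, HahnSeries.orderTop_embDomain, ← HahnSeries.order_eq_orderTop_of_ne_zero hf]
  rfl

theorem le_orderTop_lsubst (hd : 0 < d) {f : LaurentSeries F} {k : ℤ}
    (h : (k : WithTop ℤ) ≤ f.orderTop) : ((d * k : ℤ) : WithTop ℤ) ≤ (lsubst d f).orderTop := by
  by_cases hf : f = 0
  · rw [hf, lsubst, dif_pos hd, HahnSeries.embDomain_zero, HahnSeries.orderTop_zero]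
    exact le_top
  · rw [le_orderTop_iff_le_order (lsubst_ne_zero hd hf), order_lsubst hd hf]
    exact mul_le_mul_of_nonneg_left ((le_orderTop_iff_le_order hf).mp h) (by positivity)

/-- The substitution `x ↦ x ^ d` amplifies approximations of a solution of the
functional equation. -/
theorem HasApprox.of_functional_eq {g : LaurentSeries F} {P : F[X]} (hd : 0 < d)
    (hdeg : P.natDegree ≤ d - 1) (hfe : pev P * lsubst d g = g) {e : ℤ} (h : HasApprox g e) :
    HasApprox g (d * (e - 1) + 1) := by
  obtain ⟨p, q, hq, hpq⟩ := h
  refine ⟨P * expand F d p, expand F d q, ?_, ?_⟩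
  · rw [← lsubst_pev hd]
    exact lsubst_ne_zero hd hq
  · have hkey : pev (expand F d q) * g - pev (P * expand F d p) =
        pev P * lsubst d (pev q * g - pev p) := by
      rw [lsubst_sub hd, lsubst_mul hd, lsubst_pev hd, lsubst_pev hd, pev_mul]
      linear_combination -pev (expand F d q) * hfe
    rw [hkey, ← lsubst_pev hd, order_lsubst hd hq]
    refine le_trans (WithTop.coe_le_coe.mpr ?_)
      (le_orderTop_mul (neg_natDegree_le_orderTop_pev P) (le_orderTop_lsubst hd hpq))
    have : (P.natDegree : ℤ) ≤ d - 1 := by omega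
    linarith

end lsubst

/-- Let `g ∈ F((x⁻¹))` satisfy `P*(x)·g(x^d) = g(x)` with
`deg P* ≤ d-1`, `d ≥ 2`, and suppose `g` has an infinite continued fraction expansion.
Then `g` is badly approximable (the degrees of its partial quotients are uniformly
bounded) if and only if every partial quotient `a_n(x)`, `n ≥ 1`, is linear. -/
theorem badly_approximable_iff_linear (g : LaurentSeries F) (Pstar : Polynomial F)
    (d : ℕ) (hd : 2 ≤ d) (hdeg : Pstar.natDegree ≤ d - 1)
    (hfe : pev Pstar * lsubst d g = g)
    (hinf : ∀ n, cfTail g n ≠ polyPart (cfTail g n)) :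
    (∃ C : ℤ, ∀ n, 1 ≤ n → degB (cfA g n) ≤ (C : WithBot ℤ)) ↔
      (∀ n, 1 ≤ n → degB (cfA g n) = ((1 : ℤ) : WithBot ℤ)) := by
  have hd0 : 0 < d := by omega
  refine ⟨?_, fun h => ⟨1, fun n hn => (h n hn).le⟩⟩
  rintro ⟨C, hC⟩ n hn
  obtain ⟨n, rfl⟩ := Nat.exists_eq_succ_of_ne_zero (by omega : n ≠ 0)
  have htail := order_cfTail_succ_le (hinf n)
  rw [Nat.succ_eq_add_one, degB_cfA_succ (hinf n), WithBot.coe_inj]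
  by_contra hne
  have happrox : ∀ k : ℕ, HasApprox g (k + 2) := by
    intro k
    induction k with
    | zero => exact (hasApprox_of_cfTail n g hinf).mono (by push_cast; omega)
    | succ k ih =>
      refine (ih.of_functional_eq hd0 hdeg hfe).mono ?_
      have : (2 : ℤ) ≤ d := by exact_mod_cast hd
      push_cast
      nlinarith
  obtain ⟨m, hm⟩ := (happrox C.toNat).exists_le_neg_order_cfTail (by omega) hinf
  have := hC (m + 1) (by omega)
  rw [degB_cfA_succ (hinf m), WithBot.coe_le_coe] at this
  omega

end
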